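/- Let 1 ≤ d < n be integers, α₀ ∈ ℝ^{n−d}, A ∈ ℝ^{d×(n−d)}, and let Ã ∈ ℝ^{(d+1)×(n−d)} be the matrix with first row α₀ and remaining rows A. Suppose the multiplicative diophantine type satisfies ω(Ã) < (d+1)n. Then for every non-increasing approximation function ψ: ℕ → ℝ_{≥0} with ∑_{q=1}^∞ ψ(q)^n < ∞, the set {x ∈ ℝ^d : there exist infinitely many q ∈ ℕ with max(‖qx‖, ‖q·((1,x)·Ã)‖) < ψ(q)} has d-dimensional Lebesgue measure zero. (That is, the affine subspace H = {(x, (1,x)·Ã) : x ∈ ℝ^d} is of Khintchine type for convergence.) -/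

import Mathlib

open MeasureTheory
open scoped ENNReal NNReal

/-- Distance to the nearest integer. -/
noncomputable def dNI (y : ℝ) : ℝ := |y - round y|

/-- Supremum norm of an integer vector, as a natural number. -/
def jnorm {m : ℕ} (j : Fin m → ℤ) : ℕ := Finset.univ.sup fun i => (j i).natAbs

/-- The multiplicative diophantine type `ω(M)` of a matrix `M ∈ ℝ^{l×m}`:
the least upper bound of all `ω > 0` such that
`∏_{u=1}^l ‖j ⬝ row_u M‖ < |j|^{-ω}` has infinitely many solutions `j ∈ ℤ^m`. -/
noncomputable def multType {l m : ℕ} (M : Matrix (Fin l) (Fin m) ℝ) : ℝ≥0∞ :=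
  sSup {w : ℝ≥0∞ | ∃ ω : ℝ, 0 < ω ∧ w = ENNReal.ofReal ω ∧
    {j : Fin m → ℤ | j ≠ 0 ∧
      (∏ u, dNI (∑ v, (j v : ℝ) * M u v)) < (jnorm j : ℝ) ^ (-ω)}.Infinite}

/-- Squared Fourier coefficients of the indicator of `[-h, h]`. -/
noncomputable def fejerWeight (h : ℝ) (b : ℤ) : ℝ := (2 * h * Real.sinc (2 * Real.pi * b * h)) ^ 2

lemma fejerWeight_nonneg (h : ℝ) (b : ℤ) : 0 ≤ fejerWeight h b := sq_nonneg _

lemma sq_le_fejerWeight {h : ℝ} (hh : 0 < h) {b : ℤ} (hb : |(b : ℝ)| * h ≤ 1 / 4) :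
    h ^ 2 ≤ fejerWeight h b := by
  unfold fejerWeight
  have key (y : ℝ) (hy : |y| ≤ Real.pi / 2) : 1 / 2 ≤ Real.sinc y := by
    wlog h0 : 0 ≤ y generalizing y
    · rw [← Real.sinc_neg]
      exact this (-y) (by rwa [abs_neg]) (by linarith)
    rcases h0.eq_or_lt with h0 | h0
    · subst h0; norm_num
    rw [Real.sinc_of_ne_zero h0.ne', le_div_iff₀ h0]
    have h1 := Real.mul_le_sin h0.le ((le_abs_self y).trans hy)
    refine le_trans ?_ h1
    have : 1 / 2 ≤ 2 / Real.pi := by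
      rw [div_le_div_iff₀ two_pos Real.pi_pos]; linarith [Real.pi_le_four]
    gcongr
  have h2 := key (2 * Real.pi * b * h) (by
    rw [abs_mul, abs_mul, abs_of_pos hh, abs_of_pos (by positivity : 0 < 2 * Real.pi)]
    nlinarith [Real.pi_pos])
  gcongr
  nlinarith

open Complex in
lemma fejerWeight_mul_exp (h θ : ℝ) (hh : 0 < h) (b : ℤ) :
    (fejerWeight h b : ℂ) * cexp (2 * Real.pi * I * b * θ) =
      1 / (4 * Real.pi ^ 2) * (2 * (1 / (b : ℂ) ^ 2 * cexp (2 * Real.pi * I * b * θ))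
        - 1 / (b : ℂ) ^ 2 * cexp (2 * Real.pi * I * b * (θ + 2 * h))
        - 1 / (b : ℂ) ^ 2 * cexp (2 * Real.pi * I * b * (θ - 2 * h)))
      + if b = 0 then (4 * h ^ 2 : ℂ) else 0 := by
  unfold fejerWeight
  rcases eq_or_ne b 0 with rfl | hb
  · simp; ring
  have hb' : (b : ℝ) ≠ 0 := by exact_mod_cast hb
  have hbc : (b : ℂ) ≠ 0 := by exact_mod_cast hb
  have hpi : (Real.pi : ℂ) ≠ 0 := by exact_mod_cast Real.pi_ne_zero
  have hhc : (h : ℂ) ≠ 0 := by exact_mod_cast hh.ne'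
  rw [Real.sinc_of_ne_zero (by positivity), if_neg hb]
  set y : ℂ := 2 * Real.pi * b * h with hy
  have e1 : cexp (2 * Real.pi * I * b * (θ + 2 * h)) =
      cexp (2 * Real.pi * I * b * θ) * cexp (2 * y * I) := by
    rw [← Complex.exp_add]; congr 1; rw [hy]; ring
  have e2 : cexp (2 * Real.pi * I * b * (θ - 2 * h)) =
      cexp (2 * Real.pi * I * b * θ) * cexp (-(2 * y) * I) := by
    rw [← Complex.exp_add]; congr 1; rw [hy]; ring
  have e3 : cexp (2 * y * I) + cexp (-(2 * y) * I) = 2 - 4 * sin y ^ 2 := by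
    rw [← two_cos, cos_two_mul, cos_sq']; ring
  rw [e1, e2]
  push_cast
  rw [← hy]
  have : cexp (-(2 * y) * I) = 2 - 4 * sin y ^ 2 - cexp (2 * y * I) := by rw [← e3]; ring
  rw [this, hy]
  field_simp
  ring

open Complex in
lemma hasSum_one_div_sq_mul_exp {x : ℝ} (hx : x ∈ Set.Icc (0 : ℝ) 1) :
    HasSum (fun b : ℤ => 1 / (b : ℂ) ^ 2 * cexp (2 * Real.pi * I * b * x))
      (2 * (Real.pi : ℂ) ^ 2 * ((x : ℂ) ^ 2 - x + 6⁻¹)) := by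
  have := hasSum_one_div_pow_mul_fourier_mul_bernoulliFun (k := 2) le_rfl hx
  simp only [fourier_coe_apply, bernoulliFun_two] at this
  convert this using 1
  · simp
  · push_cast [Nat.factorial]
    rw [mul_pow, I_sq]; ring

lemma exp_int_mul_add_int (b k : ℤ) (x : ℂ) :
    Complex.exp (2 * Real.pi * Complex.I * b * (x + k)) =
      Complex.exp (2 * Real.pi * Complex.I * b * x) := by
  rw [Complex.exp_eq_exp_iff_exists_int]
  exact ⟨b * k, by push_cast; ring⟩

open Complex in
lemma hasSum_fejerWeight_mul_exp_of_far {h : ℝ} (hh : 0 < h) {θ : ℝ} (hθ : 2 * h ≤ dNI θ) :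
    HasSum (fun b : ℤ => (fejerWeight h b : ℂ) * cexp (2 * Real.pi * I * b * θ)) 0 := by
  rw [dNI, abs_sub_round_eq_min, le_min_iff] at hθ
  have key : HasSum (fun b : ℤ => (fejerWeight h b : ℂ) *
      cexp (2 * Real.pi * I * b * (Int.fract θ : ℝ))) 0 := by
    simp_rw [fejerWeight_mul_exp h _ hh]
    set φ := Int.fract θ
    have a := hasSum_one_div_sq_mul_exp (x := φ) ⟨by linarith, by linarith⟩
    have b := hasSum_one_div_sq_mul_exp (x := φ + 2 * h) ⟨by linarith, by linarith⟩
    have c := hasSum_one_div_sq_mul_exp (x := φ - 2 * h) ⟨by linarith, by linarith⟩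
    have e := hasSum_ite_eq (0 : ℤ) (4 * h ^ 2 : ℂ)
    push_cast at a b c
    convert ((((a.mul_left 2).sub b).sub c).mul_left (1 / (4 * Real.pi ^ 2 : ℂ))).add e using 1
    · rfl
    have hpi : (Real.pi : ℂ) ≠ 0 := by exact_mod_cast Real.pi_ne_zero
    field_simp
    ring
  convert key using 3 with b
  rw [← exp_int_mul_add_int b ⌊θ⌋ (Int.fract θ : ℝ)]
  congr 2
  exact_mod_cast (Int.fract_add_floor θ).symm

open Complex in
lemma hasSum_fejerWeight {h : ℝ} (hh : 0 < h) (h1 : 2 * h ≤ 1) :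
    HasSum (fun b : ℤ => (fejerWeight h b : ℂ)) (2 * h) := by
  have (b : ℤ) := fejerWeight_mul_exp h 0 hh b
  simp only [ofReal_zero, mul_zero, exp_zero, mul_one, zero_add, zero_sub] at this
  simp_rw [this]
  have a := hasSum_one_div_sq_mul_exp (x := 0) ⟨by linarith, by linarith⟩
  have b := hasSum_one_div_sq_mul_exp (x := 2 * h) ⟨by linarith, by linarith⟩
  have c := hasSum_one_div_sq_mul_exp (x := 1 - 2 * h) ⟨by linarith, by linarith⟩
  have e := hasSum_ite_eq (0 : ℤ) (4 * h ^ 2 : ℂ)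
  have c' : HasSum (fun b : ℤ => 1 / (b : ℂ) ^ 2 * cexp (2 * Real.pi * I * b * (-(2 * h))))
      (2 * (Real.pi : ℂ) ^ 2 * ((1 - 2 * (h : ℂ)) ^ 2 - (1 - 2 * h) + 6⁻¹)) := by
    push_cast at c
    convert c using 3 with b
    rw [← exp_int_mul_add_int b 1]
    push_cast; ring_nf
  push_cast at a b
  simp only [mul_zero, exp_zero, mul_one] at a
  convert ((((a.mul_left 2).sub b).sub c').mul_left (1 / (4 * Real.pi ^ 2 : ℂ))).add e using 1
  · rfl
  have hpi : (Real.pi : ℂ) ≠ 0 := by exact_mod_cast Real.pi_ne_zero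
  field_simp
  ring

open Complex Filter Topology in
lemma card_mul_le_of_separated {ι α : Type*} [Fintype ι] [DecidableEq ι] {h : ℝ} (hh : 0 < h)
    (h1 : 2 * h ≤ 1) (P : Finset α) (θ : α → ι → ℝ)
    (hsep : ∀ a ∈ P, ∀ a' ∈ P, a ≠ a' → ∃ u, 2 * h ≤ dNI (θ a u - θ a' u))
    (S : Finset (ι → ℤ)) (hS : ∀ b ∈ S, ∀ u, |(b u : ℝ)| * h ≤ 1 / 4)
    (hlow : ∀ b ∈ S, (P.card : ℝ) / 2 ≤
      ‖∑ a ∈ P, cexp (2 * Real.pi * I * ((∑ u, b u * θ a u : ℝ) : ℂ))‖) :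
    (S.card : ℝ) * (h ^ 2) ^ Fintype.card ι * ((P.card : ℝ) / 2) ^ 2 ≤
      P.card * (2 * h) ^ Fintype.card ι := by
  classical
  set p : (ι → ℤ) → ℂ := fun b => ∑ a ∈ P, cexp (2 * Real.pi * I * ((∑ u, b u * θ a u : ℝ) : ℂ))
  set F : Finset ℤ → ℝ := fun s =>
    ∑ b ∈ Fintype.piFinset (fun _ : ι => s), (∏ u, fejerWeight h (b u)) * ‖p b‖ ^ 2 with hF
  have hFc (s : Finset ℤ) : (F s : ℂ) = ∑ a ∈ P, ∑ a' ∈ P, ∏ u, ∑ b ∈ s,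
      (fejerWeight h b : ℂ) * cexp (2 * Real.pi * I * b * ((θ a u - θ a' u : ℝ) : ℂ)) := by
    simp_rw [Finset.prod_univ_sum]
    rw [Finset.sum_congr rfl fun a _ => Finset.sum_comm, Finset.sum_comm, hF]
    push_cast
    refine Finset.sum_congr rfl fun b _ => ?_
    rw [← Complex.mul_conj', map_sum, Finset.sum_mul_sum, Finset.mul_sum]
    refine Finset.sum_congr rfl fun a _ => ?_
    rw [Finset.mul_sum]
    refine Finset.sum_congr rfl fun a' _ => ?_
    rw [Finset.prod_mul_distrib, ← Complex.exp_sum, ← Complex.exp_conj, ← Complex.exp_add]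
    congr 2
    simp only [map_mul, conj_I, conj_ofReal, map_ofNat]
    push_cast
    simp only [Finset.mul_sum, ← Finset.sum_add_distrib]
    refine Finset.sum_congr rfl fun u _ => ?_
    ring
  have hlim : Tendsto (fun s => (F s : ℂ)) atTop
      (𝓝 (∑ a ∈ P, ∑ a' ∈ P, if a = a' then (2 * h : ℂ) ^ Fintype.card ι else 0)) := by
    simp_rw [hFc]
    refine tendsto_finsetSum _ fun a ha => tendsto_finsetSum _ fun a' ha' => ?_
    split_ifs with haa
    · subst haa
      rw [← Finset.card_univ, ← Finset.prod_const]
      refine tendsto_finsetProd _ fun u _ => ?_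
      simpa [HasSum] using hasSum_fejerWeight hh h1
    · obtain ⟨u, hu⟩ := hsep a ha a' ha' haa
      have hs (v : ι) : Summable fun b : ℤ => (fejerWeight h b : ℂ) *
          cexp (2 * Real.pi * I * b * ((θ a v - θ a' v : ℝ) : ℂ)) := by
        refine ((hasSum_fejerWeight hh h1).summable.norm.congr fun b => ?_).of_norm
        rw [norm_mul, show (2 * Real.pi * I * b * ((θ a v - θ a' v : ℝ) : ℂ)) =
          ((2 * Real.pi * b * (θ a v - θ a' v) : ℝ) : ℂ) * I by push_cast; ring,
          norm_exp_ofReal_mul_I, mul_one]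
      have := tendsto_finsetProd Finset.univ fun v _ => (hs v).hasSum
      rwa [Finset.prod_eq_zero (Finset.mem_univ u)
        (hasSum_fejerWeight_mul_exp_of_far hh hu).tsum_eq] at this
  have hlim' : Tendsto F atTop (𝓝 (P.card * (2 * h) ^ Fintype.card ι)) := by
    have := (Complex.continuous_re.tendsto _).comp hlim
    simp only [Finset.sum_ite_eq, Finset.sum_ite_mem, Finset.inter_self, Finset.sum_const,
      nsmul_eq_mul] at this
    convert this using 2
    · rfl
    rw [← Complex.ofReal_re (P.card * (2 * h) ^ Fintype.card ι)]
    push_cast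
    rfl
  refine ge_of_tendsto hlim' ?_
  filter_upwards [eventually_ge_atTop (S.biUnion fun b => Finset.univ.image b)] with s hs
  calc (S.card : ℝ) * (h ^ 2) ^ Fintype.card ι * ((P.card : ℝ) / 2) ^ 2
      = ∑ b ∈ S, (h ^ 2) ^ Fintype.card ι * ((P.card : ℝ) / 2) ^ 2 := by
        simp [mul_assoc]
    _ ≤ ∑ b ∈ S, (∏ u, fejerWeight h (b u)) * ‖p b‖ ^ 2 := by
        refine Finset.sum_le_sum fun b hb => ?_
        have : (h ^ 2) ^ Fintype.card ι ≤ ∏ u, fejerWeight h (b u) := by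
          rw [← Finset.card_univ, ← Finset.prod_const]
          exact Finset.prod_le_prod (fun _ _ => by positivity)
            fun u _ => sq_le_fejerWeight hh (hS b hb u)
        exact mul_le_mul this (by gcongr; exact hlow b hb) (by positivity)
          (Finset.prod_nonneg fun _ _ => fejerWeight_nonneg _ _)
    _ ≤ F s := by
        refine Finset.sum_le_sum_of_subset_of_nonneg (fun b hb => ?_) fun b _ _ => ?_
        · rw [Fintype.mem_piFinset]
          exact fun u => hs (Finset.mem_biUnion.2 ⟨b, hb, Finset.mem_image_of_mem _ (Finset.mem_univ u)⟩)
        · exact mul_nonneg (Finset.prod_nonneg fun _ _ => fejerWeight_nonneg _ _) (sq_nonneg _)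

lemma half_le_cos_two_pi_mul {y : ℝ} (k : ℤ) (hy : |y - k| ≤ 1 / 8) :
    1 / 2 ≤ Real.cos (2 * Real.pi * y) := by
  have e : Real.cos (2 * Real.pi * y) = Real.cos (2 * Real.pi * (y - k)) := by
    rw [← Real.cos_sub_int_mul_two_pi (2 * Real.pi * y) k]
    congr 1; ring
  rw [e]
  refine le_trans ?_ (Real.one_sub_sq_div_two_le_cos)
  have h1 : |2 * Real.pi * (y - k)| ≤ 1 := by
    rw [abs_mul, abs_of_pos (by positivity : 0 < 2 * Real.pi)]
    nlinarith [Real.pi_lt_four, Real.pi_pos, abs_nonneg (y - k)]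
  have := (sq_le_one_iff_abs_le_one _).2 h1
  linarith

lemma jnorm_le_iff {m : ℕ} {j : Fin m → ℤ} {N : ℕ} : jnorm j ≤ N ↔ ∀ v, |j v| ≤ N := by
  unfold jnorm
  simp only [Finset.sup_le_iff, Finset.mem_univ, true_implies]
  exact forall_congr' fun v => by rw [Int.abs_eq_natAbs]; norm_cast

lemma card_le_of_dual_far {k m : ℕ} (hm : 0 < m) (M : Matrix (Fin k) (Fin m) ℝ) {T δ : ℝ}
    (hT : 1 ≤ T) (hδ : 0 < δ) (hδ1 : 8 * m * δ ≤ 1)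
    (hfar : ∀ j : Fin m → ℤ, j ≠ 0 → (jnorm j : ℝ) * (8 * m * δ) ≤ 1 →
      ∃ u, 1 / (2 * T) ≤ dNI (∑ v, (j v : ℝ) * M u v))
    (S : Finset (Fin k → ℤ)) (hS : ∀ b ∈ S, ∀ u, |(b u : ℝ)| ≤ T)
    (hSδ : ∀ b ∈ S, ∀ v, dNI (∑ u, (b u : ℝ) * M u v) < δ) :
    (S.card : ℝ) ≤ 4 * (8 * T) ^ k * (16 * m * δ) ^ m := by
  have hm' : (1 : ℝ) ≤ m := by exact_mod_cast hm
  have hc : 0 < 8 * m * δ := by positivity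
  set J : ℕ := ⌊1 / (8 * m * δ)⌋₊ with hJ
  have hJ1 : 1 ≤ J := Nat.le_floor (by rw [Nat.cast_one, le_div_iff₀ hc]; linarith)
  have hJ1' : (1 : ℝ) ≤ J := by exact_mod_cast hJ1
  have hJle : (J : ℝ) * (8 * m * δ) ≤ 1 := by
    rw [← le_div_iff₀ hc]; exact Nat.floor_le (by positivity)
  have hJge : 1 ≤ (J : ℝ) * (16 * m * δ) := by
    have : 1 / (8 * m * δ) < J + 1 := Nat.lt_floor_add_one _
    rw [div_lt_iff₀ hc] at this
    nlinarith
  set P : Finset (Fin m → ℤ) := Fintype.piFinset fun _ => Finset.Ico (0 : ℤ) J with hP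
  have hPc : P.card = J ^ m := by simp [hP]
  have hmem {a : Fin m → ℤ} (ha : a ∈ P) (v : Fin m) : 0 ≤ a v ∧ a v < J := by
    simpa using Fintype.mem_piFinset.1 ha v
  have key := card_mul_le_of_separated (h := 1 / (4 * T)) (by positivity)
    (by rw [mul_one_div, div_le_one (by positivity)]; linarith) P
    (fun a u => ∑ v, (a v : ℝ) * M u v) ?_ S ?_ ?_
  · rw [hPc, Fintype.card_fin] at key
    push_cast at key
    have hJm : (0 : ℝ) < J ^ m := by positivity
    have k1 : (S.card : ℝ) * (((1 / (4 * T)) ^ 2) ^ k * J ^ m / 4) ≤ (2 * (1 / (4 * T))) ^ k := by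
      refine le_of_mul_le_mul_left ?_ hJm
      linarith
    have k2 : (S.card : ℝ) * J ^ m ≤ 4 * (8 * T) ^ k := by
      have : (2 * (1 / (4 * T))) ^ k = (8 * T) ^ k * ((1 / (4 * T)) ^ 2) ^ k := by
        rw [← mul_pow]; congr 1; field_simp; norm_num
      rw [this] at k1
      have hp : 0 < ((1 / (4 * T)) ^ 2) ^ k := by positivity
      refine le_of_mul_le_mul_left ?_ hp
      linarith
    calc (S.card : ℝ) ≤ S.card * ((J : ℝ) * (16 * m * δ)) ^ m :=
          le_mul_of_one_le_right (by positivity) (one_le_pow₀ hJge)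
      _ = (S.card * J ^ m) * (16 * m * δ) ^ m := by rw [mul_pow (J : ℝ)]; exact (mul_assoc _ _ _).symm
      _ ≤ _ := by gcongr
  · intro a ha a' ha' hne
    obtain ⟨u, hu⟩ := hfar (a - a') (sub_ne_zero.2 hne) (by
      refine le_trans ?_ hJle
      gcongr
      refine jnorm_le_iff.2 fun v => abs_le.2 ?_
      have := hmem ha v
      have := hmem ha' v
      simp only [Pi.sub_apply]
      constructor <;> linarith)
    refine ⟨u, ?_⟩
    simp only [Pi.sub_apply, Int.cast_sub, sub_mul, Finset.sum_sub_distrib] at hu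
    convert hu using 1
    field_simp; norm_num
  · intro b hb u
    rw [mul_one_div, div_le_div_iff₀ (by positivity) (by positivity)]
    linarith [hS b hb u]
  · intro b hb
    refine le_trans ?_ (Complex.re_le_norm _)
    rw [Complex.re_sum, div_eq_mul_one_div, ← nsmul_eq_mul]
    refine Finset.card_nsmul_le_sum _ _ _ fun a ha => ?_
    rw [show (2 * Real.pi * Complex.I * ((∑ u, b u * ∑ v, (a v : ℝ) * M u v : ℝ) : ℂ)) =
      ((2 * Real.pi * (∑ u, b u * ∑ v, (a v : ℝ) * M u v) : ℝ) : ℂ) * Complex.I by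
        push_cast; ring, Complex.exp_ofReal_mul_I_re]
    refine half_le_cos_two_pi_mul (∑ v, a v * round (∑ u, (b u : ℝ) * M u v)) ?_
    have : ∑ u, b u * ∑ v, (a v : ℝ) * M u v = ∑ v, a v * ∑ u, (b u : ℝ) * M u v := by
      simp only [Finset.mul_sum]
      rw [Finset.sum_comm]
      exact Finset.sum_congr rfl fun _ _ => Finset.sum_congr rfl fun _ _ => by ring
    rw [this]
    push_cast
    rw [← Finset.sum_sub_distrib]
    calc |∑ v, _| ≤ ∑ v : Fin m, J * δ := by
          refine (Finset.abs_sum_le_sum_abs _ _).trans (Finset.sum_le_sum fun v _ => ?_)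
          rw [← mul_sub, abs_mul]
          have h1 := hmem ha v
          refine mul_le_mul ?_ (hSδ b hb v).le (abs_nonneg _) (by positivity)
          rw [abs_of_nonneg (by exact_mod_cast h1.1)]
          exact_mod_cast h1.2.le
      _ ≤ 1 / 8 := by simp; linarith

lemma dNI_nonneg (y : ℝ) : 0 ≤ dNI y := abs_nonneg _

lemma dNI_le (y : ℝ) (k : ℤ) : dNI y ≤ |y - k| := round_le y k

lemma dNI_natCast_mul_eq_zero {y : ℝ} (hy : dNI y = 0) (k : ℕ) : dNI (k * y) = 0 := by
  have h : y = round y := sub_eq_zero.1 (abs_eq_zero.1 hy)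
  refine le_antisymm ((dNI_le _ (k * round y)).trans ?_) (dNI_nonneg _)
  push_cast
  rw [← h]
  simp

lemma jnorm_pos {m : ℕ} {j : Fin m → ℤ} (hj : j ≠ 0) : 1 ≤ jnorm j := by
  by_contra! h
  have : jnorm j ≤ 0 := by lia
  refine hj (funext fun v => ?_)
  simpa using jnorm_le_iff.1 this v

lemma exists_le_prod_dNI {l m : ℕ} (M : Matrix (Fin l) (Fin m) ℝ) {W : ℕ}
    (hM : multType M < (W : ℝ≥0∞)) :
    ∃ ω c : ℝ, 0 < ω ∧ ω < W ∧ 0 < c ∧ ∀ j : Fin m → ℤ, j ≠ 0 →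
      c * (jnorm j : ℝ) ^ (-ω) ≤ ∏ u, dNI (∑ v, (j v : ℝ) * M u v) := by
  obtain ⟨w, hw1, hw2⟩ := ENNReal.lt_iff_exists_nnreal_btwn.1 hM
  have hw0 : 0 < (w : ℝ) := by
    have : (0 : ℝ≥0∞) < w := hw1.bot_lt
    exact_mod_cast this
  set f : (Fin m → ℤ) → ℝ := fun j => ∏ u, dNI (∑ v, (j v : ℝ) * M u v) with hf
  set B := {j : Fin m → ℤ | j ≠ 0 ∧ f j < (jnorm j : ℝ) ^ (-(w : ℝ))} with hB
  have hfin : B.Finite := by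
    by_contra hinf
    refine hw1.not_ge (le_sSup ⟨w, hw0, by simp, hinf⟩)
  have hpos (j : Fin m → ℤ) (hj : j ≠ 0) : 0 < f j := by
    refine (Finset.prod_nonneg fun _ _ => dNI_nonneg _).lt_of_ne fun h0 => ?_
    obtain ⟨u, -, hu⟩ := Finset.prod_eq_zero_iff.1 h0.symm
    refine Set.infinite_of_injective_forall_mem (f := fun k : ℕ => (k + 1) • j) ?_ ?_ hfin
    · intro k k' hk
      obtain ⟨v, hv⟩ := Function.ne_iff.1 hj
      have := congrFun hk v
      simp only [Pi.smul_apply, nsmul_eq_mul] at this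
      have := mul_right_cancel₀ hv this
      push_cast at this
      lia
    · intro k
      have hne : (k + 1) • j ≠ 0 := smul_ne_zero (by simp) hj
      refine ⟨hne, ?_⟩
      have : f ((k + 1) • j) = 0 := by
        refine Finset.prod_eq_zero (Finset.mem_univ u) ?_
        rw [← dNI_natCast_mul_eq_zero hu (k + 1), Finset.mul_sum]
        simp [mul_assoc]
      rw [this]
      have : (0 : ℝ) < jnorm ((k + 1) • j) := by exact_mod_cast jnorm_pos hne
      positivity
  obtain ⟨c, hc, hcB⟩ : ∃ c : ℝ, 0 < c ∧ ∀ j ∈ B, c ≤ f j := by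
    rcases B.eq_empty_or_nonempty with he | hne
    · exact ⟨1, one_pos, by simp [he]⟩
    · obtain ⟨j, hj, hmin⟩ := Set.exists_min_image B f hfin hne
      exact ⟨f j, hpos j hj.1, hmin⟩
  refine ⟨w, min c 1, hw0, by exact_mod_cast hw2, by positivity, fun j hj => ?_⟩
  have h1 : (1 : ℝ) ≤ jnorm j := by exact_mod_cast jnorm_pos hj
  have h2 : (jnorm j : ℝ) ^ (-(w : ℝ)) ≤ 1 := Real.rpow_le_one_of_one_le_of_nonpos h1 (by linarith)
  have h3 : 0 ≤ (jnorm j : ℝ) ^ (-(w : ℝ)) := by positivity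
  by_cases hjB : j ∈ B
  · calc min c 1 * (jnorm j : ℝ) ^ (-(w : ℝ)) ≤ c * 1 :=
        mul_le_mul (min_le_left _ _) h2 h3 hc.le
      _ ≤ f j := by rw [mul_one]; exact hcB j hjB
  · have : (jnorm j : ℝ) ^ (-(w : ℝ)) ≤ f j := by
      by_contra! h
      exact hjB ⟨hj, h⟩
    exact (mul_le_of_le_one_left h3 (min_le_right _ _)).trans this

lemma dNI_le_add (y z : ℝ) : dNI y ≤ dNI z + |y - z| := by
  refine (dNI_le y (round z)).trans ?_
  rw [dNI, add_comm]
  exact abs_sub_le y z _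

open Filter in
lemma eventually_card_le {k m : ℕ} (hm : 0 < m) (M : Matrix (Fin k) (Fin m) ℝ)
    {ω c r R D : ℝ} (hω : 0 < ω) (hc : 0 < c)
    (hM : ∀ j : Fin m → ℤ, j ≠ 0 → c * (jnorm j : ℝ) ^ (-ω) ≤ ∏ u, dNI (∑ v, (j v : ℝ) * M u v))
    (hr : 0 < r) (hrω : 1 < 2 ^ k * r ^ ω) (hR : 1 ≤ R) (hD : 1 ≤ D) (δ : ℕ → ℝ)
    (hδr : ∀ t, r ^ t ≤ δ t) (hδ : Tendsto δ atTop (nhds 0)) :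
    ∃ C : ℝ, 0 < C ∧ ∀ᶠ t in atTop, ∀ S : Finset (Fin k → ℤ),
      (∀ b ∈ S, ∀ u, |(b u : ℝ)| ≤ R * 2 ^ t) →
      (∀ b ∈ S, ∀ v, dNI (∑ u, (b u : ℝ) * M u v) < D * δ t) →
      (S.card : ℝ) ≤ C * (2 ^ t) ^ k * δ t ^ m := by
  have hm' : (1 : ℝ) ≤ m := by exact_mod_cast hm
  refine ⟨4 * (8 * R) ^ k * (16 * m * D) ^ m, by positivity, ?_⟩
  have e1 : ∀ᶠ t in atTop, δ t < 1 / (8 * m * D) := hδ.eventually_lt_const (by positivity)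
  have e2 := (tendsto_pow_atTop_atTop_of_one_lt hrω).eventually_gt_atTop (1 / c)
  filter_upwards [e1, e2] with t h1 h2 S hS hSδ
  have hrt : 0 < r ^ t := by positivity
  have hδ0 : 0 < δ t := hrt.trans_le (hδr t)
  have h2t : (1 : ℝ) ≤ 2 ^ t := one_le_pow₀ (by norm_num)
  rw [lt_div_iff₀ (by positivity)] at h1
  refine (card_le_of_dual_far hm M (T := R * 2 ^ t) (δ := D * δ t) (by nlinarith) (by positivity)
    (by linarith) (fun j hj hjn => ?_) S hS hSδ).trans_eq ?_
  · by_contra! hlt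
    have hj1 : (1 : ℝ) ≤ jnorm j := by exact_mod_cast jnorm_pos hj
    have hjr : (jnorm j : ℝ) ≤ (r ^ t)⁻¹ := by
      rw [← one_div, le_div_iff₀ hrt]
      refine le_trans ?_ hjn
      gcongr
      calc r ^ t ≤ 1 * δ t := by rw [one_mul]; exact hδr t
        _ ≤ (8 * m * D) * δ t := by gcongr; nlinarith
        _ = _ := by ring
    have hlow : c * (r ^ ω) ^ t ≤ ∏ u, dNI (∑ v, (j v : ℝ) * M u v) := by
      refine le_trans ?_ (hM j hj)
      gcongr
      calc (r ^ ω) ^ t = ((r ^ t)⁻¹) ^ (-ω) := by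
            rw [Real.inv_rpow hrt.le, Real.rpow_neg hrt.le, inv_inv,
              ← Real.rpow_natCast, ← Real.rpow_natCast, ← Real.rpow_mul hr.le,
              ← Real.rpow_mul hr.le, mul_comm]
        _ ≤ (jnorm j : ℝ) ^ (-ω) :=
            Real.rpow_le_rpow_of_nonpos (by linarith) hjr (by linarith)
    have hup : ∏ u, dNI (∑ v, (j v : ℝ) * M u v) ≤ ((2 ^ t : ℝ)⁻¹) ^ k := by
      calc _ ≤ ∏ u : Fin k, (2 ^ t : ℝ)⁻¹ := by
            refine Finset.prod_le_prod (fun _ _ => dNI_nonneg _) fun u _ => (hlt u).le.trans ?_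
            rw [← one_div]
            gcongr
            nlinarith
        _ = _ := by simp
    have h3 := hlow.trans hup
    rw [div_lt_iff₀ hc, mul_pow] at h2
    have h4 : ((2 : ℝ) ^ k) ^ t * ((2 ^ t : ℝ)⁻¹) ^ k = 1 := by
      rw [inv_pow, ← pow_mul, ← pow_mul, mul_comm k t]
      exact mul_inv_cancel₀ (by positivity)
    have h5 : (0 : ℝ) < (2 ^ k) ^ t := by positivity
    nlinarith [mul_le_mul_of_nonneg_left h3 h5.le]
  · simp only [mul_pow]; ring

open Filter in
lemma summable_two_pow_mul_max {n : ℕ} {r : ℝ} (hr : 0 < r) (hrn : 2 * r ^ n < 1)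
    {ψ : ℕ → ℝ} (hψ : ∀ q, 0 ≤ ψ q) (hmono : Antitone ψ) (hsum : Summable fun q => ψ q ^ n) :
    Summable fun t : ℕ => (2 : ℝ) ^ t * max (ψ (2 ^ t)) (r ^ t) ^ n := by
  have h1 : Summable fun t : ℕ => (2 : ℝ) ^ t * ψ (2 ^ t) ^ n :=
    (summable_condensed_iff_of_nonneg (f := fun q => ψ q ^ n) (fun q => pow_nonneg (hψ q) n)
      fun a b _ hab => pow_le_pow_left₀ (hψ b) (hmono hab) n).2 hsum
  have h2 : Summable fun t : ℕ => (2 * r ^ n) ^ t :=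
    summable_geometric_of_lt_one (by positivity) hrn
  refine (h1.add h2).of_nonneg_of_le (fun t => by positivity) fun t => ?_
  have e : (2 * r ^ n) ^ t = 2 ^ t * (r ^ t) ^ n := by
    rw [mul_pow, ← pow_mul, ← pow_mul, mul_comm n t]
  rw [e, ← mul_add]
  gcongr
  rcases max_choice (ψ (2 ^ t)) (r ^ t) with h | h <;> rw [h]
  · exact le_add_of_nonneg_right (by positivity)
  · exact le_add_of_nonneg_left (pow_nonneg (hψ _) n)

open Filter in
lemma tendsto_zero_of_summable_two_pow_mul {n : ℕ} {δ : ℕ → ℝ} (hδ : ∀ t, 0 ≤ δ t)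
    (h : Summable fun t : ℕ => (2 : ℝ) ^ t * δ t ^ n) : Tendsto δ atTop (nhds 0) := by
  rw [Metric.tendsto_atTop']
  have := h.tendsto_atTop_zero
  refine fun ε hε => eventually_atTop.1 ?_ |>.imp fun a ha b hb => ha b hb.le
  filter_upwards [this.eventually_lt_const (show 0 < ε ^ n by positivity)] with t ht
  rw [Real.dist_eq, sub_zero, abs_of_nonneg (hδ t)]
  refine lt_of_pow_lt_pow_left₀ n hε.le (lt_of_le_of_lt ?_ ht)
  exact le_mul_of_one_le_left (pow_nonneg (hδ t) n) (one_le_pow₀ (by norm_num))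

lemma exists_ratio {ω : ℝ} {k n : ℕ} (hω : 0 < ω) (hn : 0 < n) (h : ω < (k * n : ℕ)) :
    ∃ r : ℝ, 0 < r ∧ 1 < 2 ^ k * r ^ ω ∧ 2 * r ^ n < 1 := by
  have hn' : (0 : ℝ) < n := by exact_mod_cast hn
  push_cast at h
  obtain ⟨s, hs1, hs2⟩ := exists_between (show 1 / (n : ℝ) < k / ω by
    rw [div_lt_div_iff₀ hn' hω]; linarith)
  rw [div_lt_iff₀ hn'] at hs1
  rw [lt_div_iff₀ hω] at hs2
  refine ⟨2 ^ (-s), by positivity, ?_, ?_⟩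
  · rw [← Real.rpow_natCast, ← Real.rpow_mul two_pos.le, ← Real.rpow_add two_pos]
    exact Real.one_lt_rpow one_lt_two (by linarith)
  · rw [← Real.rpow_natCast, ← Real.rpow_mul two_pos.le]
    nth_rw 1 [← Real.rpow_one 2]
    rw [← Real.rpow_add two_pos]
    exact Real.rpow_lt_one_of_one_lt_of_neg one_lt_two (by linarith)

/-- The points of the box `[-R, R]^d` that are `ψ`-approximated with a denominator in the
dyadic range `[2^t, 2^(t+1))`. -/
def approxBlock {d m : ℕ} (M : Matrix (Fin (d + 1)) (Fin m) ℝ) (ψ : ℕ → ℝ) (R : ℝ) (t : ℕ) :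
    Set (Fin d → ℝ) :=
  {x | (∀ i, |x i| ≤ R) ∧ ∃ q : ℕ, 2 ^ t ≤ q ∧ q < 2 ^ (t + 1) ∧ (∀ i, dNI ((q : ℝ) * x i) < ψ q) ∧
    ∀ v, dNI ((q : ℝ) * ∑ u, (Fin.cons (1 : ℝ) x : Fin (d + 1) → ℝ) u * M u v) < ψ q}

lemma volume_approxBlock_le {d m : ℕ} (M : Matrix (Fin (d + 1)) (Fin m) ℝ) {ψ : ℕ → ℝ}
    (hmono : Antitone ψ) {R : ℝ} (hR : 0 ≤ R) (t : ℕ) {δ N : ℝ} (hψδ : ψ (2 ^ t) ≤ δ) (hδ : 0 < δ)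
    (hN : ∀ S : Finset (Fin (d + 1) → ℤ),
      (∀ b ∈ S, ∀ u, |(b u : ℝ)| ≤ (2 * R + 2) * 2 ^ t) →
      (∀ b ∈ S, ∀ v, dNI (∑ u, (b u : ℝ) * M u v) < (1 + ∑ u, ∑ v, |M u v|) * δ) →
      (S.card : ℝ) ≤ N) :
    volume (approxBlock M ψ R t) ≤ ENNReal.ofReal (N * (2 * (δ / 2 ^ t)) ^ d) := by
  classical
  set B : ℤ := ⌊(2 * R + 2) * 2 ^ t⌋
  set S : Finset (Fin (d + 1) → ℤ) := {b ∈ Fintype.piFinset fun _ => Finset.Icc (-B) B |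
    ∀ v, dNI (∑ u, (b u : ℝ) * M u v) < (1 + ∑ u, ∑ v, |M u v|) * δ}
  have hB {z : ℤ} : z ∈ Finset.Icc (-B) B ↔ |(z : ℝ)| ≤ (2 * R + 2) * 2 ^ t := by
    rw [Finset.mem_Icc, ← abs_le, Int.le_floor]
    push_cast; rfl
  have hcard : (S.card : ℝ) ≤ N := by
    refine hN S (fun b hb u => ?_) fun b hb => (Finset.mem_filter.1 hb).2
    exact hB.1 (Fintype.mem_piFinset.1 (Finset.mem_filter.1 hb).1 u)
  have h2t : (1 : ℝ) ≤ 2 ^ t := one_le_pow₀ (by norm_num)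
  have hcover : approxBlock M ψ R t ⊆
      ⋃ b ∈ S, Metric.ball (fun i => (b (Fin.succ i) : ℝ) / b 0) (δ / 2 ^ t) := by
    rintro x ⟨hxR, q, hq1, hq2, hqx, hqM⟩
    have hq1' : (2 : ℝ) ^ t ≤ q := by exact_mod_cast hq1
    have hq2' : (q : ℝ) ≤ 2 * 2 ^ t := by
      have : (q : ℝ) < 2 ^ (t + 1) := by exact_mod_cast hq2
      rw [pow_succ] at this; linarith
    have hq0 : (0 : ℝ) < q := by linarith
    have hψq : ψ q ≤ δ := (hmono hq1).trans hψδ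
    set b : Fin (d + 1) → ℤ := Fin.cons (q : ℤ) fun i => round ((q : ℝ) * x i) with hb
    have hdiff (u : Fin (d + 1)) :
        |(b u : ℝ) - q * (Fin.cons (1 : ℝ) x : Fin (d + 1) → ℝ) u| ≤ δ := by
      refine Fin.cases ?_ (fun i => ?_) u
      · simpa [hb] using hδ.le
      · rw [abs_sub_comm]
        simp only [hb, Fin.cons_succ]
        exact (hqx i).le.trans hψq
    refine Set.mem_iUnion₂.2 ⟨b, Finset.mem_filter.2 ⟨Fintype.mem_piFinset.2 fun u => hB.2 ?_,
      fun v => ?_⟩, ?_⟩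
    · refine Fin.cases ?_ (fun i => ?_) u
      · simp only [hb, Fin.cons_zero, Int.cast_natCast, Nat.abs_cast]
        nlinarith
      · have h1 : |(q : ℝ) * x i - round ((q : ℝ) * x i)| ≤ 1 / 2 := abs_sub_round _
        have h2 : |(q : ℝ) * x i| ≤ 2 * 2 ^ t * R := by
          rw [abs_mul, Nat.abs_cast]
          exact mul_le_mul hq2' (hxR i) (abs_nonneg _) (by positivity)
        simp only [hb, Fin.cons_succ]
        rw [abs_le] at *
        constructor <;> nlinarith
    · refine (dNI_le_add _ (q * ∑ u, (Fin.cons (1 : ℝ) x : Fin (d + 1) → ℝ) u * M u v)).trans_lt ?_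
      rw [add_mul, one_mul]
      refine add_lt_add_of_lt_of_le ((hqM v).trans_le hψq) ?_
      rw [Finset.mul_sum, ← Finset.sum_sub_distrib, Finset.sum_mul]
      refine (Finset.abs_sum_le_sum_abs _ _).trans (Finset.sum_le_sum fun u _ => ?_)
      rw [← mul_assoc, ← sub_mul, abs_mul, mul_comm]
      exact mul_le_mul (Finset.single_le_sum (f := fun v => |M u v|) (fun _ _ => abs_nonneg _)
        (Finset.mem_univ v)) (hdiff u) (abs_nonneg _)
        (Finset.sum_nonneg fun _ _ => abs_nonneg _)
    · rw [Metric.mem_ball, dist_pi_lt_iff (by positivity)]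
      intro i
      have h1 : x i - (b i.succ : ℝ) / b 0 = (q * x i - round ((q : ℝ) * x i)) / q := by
        simp only [hb, Fin.cons_succ, Fin.cons_zero, Int.cast_natCast]
        field_simp
      rw [Real.dist_eq, h1, abs_div, Nat.abs_cast, div_lt_div_iff₀ hq0 (by positivity)]
      exact mul_lt_mul ((hqx i).trans_le hψq) hq1' (by positivity) hδ.le
  calc volume (approxBlock M ψ R t)
      ≤ ∑ b ∈ S, volume (Metric.ball (fun i : Fin d => (b (Fin.succ i) : ℝ) / b 0) (δ / 2 ^ t)) :=
        (measure_mono hcover).trans (measure_biUnion_finset_le _ _)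
    _ = ENNReal.ofReal (S.card * (2 * (δ / 2 ^ t)) ^ d) := by
        simp_rw [Real.volume_pi_ball _ (show 0 < δ / 2 ^ t by positivity)]
        rw [Finset.sum_const, nsmul_eq_mul, ENNReal.ofReal_mul (by positivity),
          ENNReal.ofReal_natCast, Fintype.card_fin]
    _ ≤ _ := by gcongr

open Filter in
lemma mem_limsup_approxBlock {d m : ℕ} {M : Matrix (Fin (d + 1)) (Fin m) ℝ} {ψ : ℕ → ℝ} {R : ℝ}
    {x : Fin d → ℝ} (hxR : ∀ i, |x i| ≤ R) (t₀ : ℕ)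
    (hx : {q : ℕ | 0 < q ∧ (∀ i, dNI ((q : ℝ) * x i) < ψ q) ∧
        (∀ v, dNI ((q : ℝ) * ∑ u, (Fin.cons (1 : ℝ) x : Fin (d + 1) → ℝ) u * M u v) < ψ q)}.Infinite) :
    x ∈ limsup (fun t => approxBlock M ψ R (t + t₀)) atTop := by
  rw [mem_limsup_iff_frequently_mem, frequently_atTop]
  intro a
  obtain ⟨q, ⟨hq0, hq⟩, hqa⟩ := hx.exists_gt (2 ^ (a + t₀))
  have hlog : a + t₀ ≤ Nat.log 2 q := Nat.le_log_of_pow_le (by norm_num) hqa.le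
  refine ⟨Nat.log 2 q - t₀, by lia, hxR, q, ?_, ?_, hq⟩
  · rw [Nat.sub_add_cancel (by lia)]
    exact Nat.pow_log_le_self 2 hq0.ne'
  · rw [Nat.sub_add_cancel (by lia)]
    exact Nat.lt_pow_succ_log_self (by norm_num) q

theorem Khintchine_type_for_convergence
    (n d : ℕ) (hd : 1 ≤ d) (hdn : d < n)
    (α₀ : Fin (n - d) → ℝ) (A : Matrix (Fin d) (Fin (n - d)) ℝ)
    (Atil : Matrix (Fin (d + 1)) (Fin (n - d)) ℝ)
    (hAtil : Atil = Matrix.of (Fin.cons α₀ A))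
    (hω : multType Atil < (((d + 1) * n : ℕ) : ℝ≥0∞))
    (ψ : ℕ → ℝ) (hψ : ∀ q, 0 ≤ ψ q) (hmono : Antitone ψ)
    (hsum : Summable fun q : ℕ => ψ q ^ n) :
    volume {x : Fin d → ℝ |
      {q : ℕ | 0 < q ∧ (∀ i, dNI ((q : ℝ) * x i) < ψ q) ∧
        (∀ v, dNI ((q : ℝ) * ∑ u, (Fin.cons (1 : ℝ) x : Fin (d+1) → ℝ) u * Atil u v) < ψ q)}.Infinite} = 0 := by
  obtain ⟨ω, c, hω0, hωW, hc, hM⟩ := exists_le_prod_dNI Atil hω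
  obtain ⟨r, hr, hrω, hrn⟩ := exists_ratio hω0 (by lia : 0 < n) hωW
  set δ : ℕ → ℝ := fun t => max (ψ (2 ^ t)) (r ^ t)
  have hδ0 (t : ℕ) : 0 < δ t := lt_max_of_lt_right (by positivity)
  have hδs : Summable fun t : ℕ => (2 : ℝ) ^ t * δ t ^ n :=
    summable_two_pow_mul_max hr hrn hψ hmono hsum
  have hδ := tendsto_zero_of_summable_two_pow_mul (fun t => (hδ0 t).le) hδs
  have hnull (R : ℕ) : volume {x : Fin d → ℝ | (∀ i, |x i| ≤ R) ∧
      {q : ℕ | 0 < q ∧ (∀ i, dNI ((q : ℝ) * x i) < ψ q) ∧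
        (∀ v, dNI ((q : ℝ) * ∑ u, (Fin.cons (1 : ℝ) x : Fin (d+1) → ℝ) u * Atil u v) < ψ q)}.Infinite} = 0 := by
    obtain ⟨C, hC, hev⟩ := eventually_card_le (by lia : 0 < n - d) Atil (R := 2 * R + 2)
      (D := 1 + ∑ u, ∑ v, |Atil u v|) hω0 hc hM hr hrω (by linarith [R.cast_nonneg (α := ℝ)])
      (le_add_of_nonneg_right
        (Finset.sum_nonneg fun _ _ => Finset.sum_nonneg fun _ _ => abs_nonneg _))
      δ (fun t => le_max_right _ _) hδ
    obtain ⟨t₀, ht₀⟩ := Filter.eventually_atTop.1 hev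
    have hvol (t : ℕ) : volume (approxBlock Atil ψ R (t + t₀)) ≤
        ENNReal.ofReal (C * 2 ^ d * (2 ^ (t + t₀) * δ (t + t₀) ^ n)) := by
      refine (volume_approxBlock_le Atil hmono R.cast_nonneg (t + t₀) (le_max_left _ _)
        (hδ0 (t + t₀)) (ht₀ (t + t₀) (by lia))).trans_eq ?_
      congr 1
      obtain ⟨m, rfl⟩ := Nat.exists_eq_add_of_lt hdn
      rw [show d + m + 1 - d = m + 1 by lia]
      have e (y p : ℝ) (hp : p ≠ 0) : C * p ^ (d + 1) * y ^ (m + 1) * (2 * (y / p)) ^ d =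
          C * 2 ^ d * (p * y ^ (d + m + 1)) := by
        rw [mul_pow, div_pow]
        field_simp
        ring
      exact e _ _ (by positivity)
    refine measure_mono_null (fun x hx => mem_limsup_approxBlock hx.1 t₀ hx.2)
      (measure_limsup_atTop_eq_zero (ne_top_of_le_ne_top ?_ (ENNReal.tsum_le_tsum hvol)))
    exact (((summable_nat_add_iff t₀).2 hδs).mul_left (C * 2 ^ d)).tsum_ofReal_ne_top
  refine measure_mono_null (fun x hx => ?_) (measure_iUnion_null hnull)
  obtain ⟨R, hR⟩ := exists_nat_ge ‖x‖
  exact Set.mem_iUnion.2 ⟨R, fun i => (norm_le_pi_norm x i).trans hR, hx⟩
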